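/- A finite graph G is online-perfect (f(w,G) = w for every positive integer w) if and only if G is obtainable from a bipartite graph by replacing each vertex with a copy of a P_4-free graph (substituting a P_4-free graph for each vertex, where vertices in the substituted copies at two vertices of the bipartite graph are all adjacent or all nonadjacent according to whether those two vertices were adjacent). -/

import Mathlib

/-!  Common definitions: the online token-coloring game of Milans–Wigal. -/

/-- Tokens `i` and `j` of the play `s` (Spoiler's `i`-th move is at vertex `s i`) are
adjacent in the token graph: they are distinct tokens lying on the same vertex or on
adjacent vertices of `G`. -/
def TokenAdj {V : Type*} (G : SimpleGraph V) (s : ℕ → V) (i j : ℕ) : Prop :=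
  i ≠ j ∧ (s i = s j ∨ G.Adj (s i) (s j))

/-- The play consisting of the first `n` tokens of `s` is legal for Spoiler in the game of
width `w`: the token graph on these `n` tokens has chromatic number at most `w`. -/
def LegalPlay {V : Type*} (G : SimpleGraph V) (w : ℕ) (s : ℕ → V) (n : ℕ) : Prop :=
  ∃ φ : ℕ → ℕ, (∀ i, i < n → φ i < w) ∧
    ∀ i j, i < n → j < n → TokenAdj G s i j → φ i ≠ φ j

/-- The color that Algorithm's (deterministic, online) strategy `σ` assigns to the `i`-th
token of the play `s`: `σ` is applied to the history of Spoiler's moves up to and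
including the `i`-th one. -/
def colorOf {V : Type*} (σ : List V → ℕ) (s : ℕ → V) (i : ℕ) : ℕ :=
  σ (List.ofFn fun j : Fin (i + 1) => s j)

/-- Strategy `σ` for Algorithm wins the token game on `G` of width `w` using at most `k`
colors: against every legal Spoiler play, all assigned colors lie in `{0, …, k-1}` and the
resulting coloring of the token graph is proper. -/
def AlgWins {V : Type*} (G : SimpleGraph V) (w k : ℕ) (σ : List V → ℕ) : Prop :=
  ∀ (n : ℕ) (s : ℕ → V), LegalPlay G w s n →
    (∀ i, i < n → colorOf σ s i < k) ∧
    ∀ i j, i < n → j < n → TokenAdj G s i j → colorOf σ s i ≠ colorOf σ s j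

/-- `gameValue G w` is the value `f(w, G)` of the token game on `G` of width `w`: the
minimum number of colors with which Algorithm has a winning strategy. -/
noncomputable def gameValue {V : Type*} (G : SimpleGraph V) (w : ℕ) : ℕ :=
  sInf {k | ∃ σ : List V → ℕ, AlgWins G w k σ}

open SimpleGraph

section Game

variable {V : Type*} {G : SimpleGraph V} {w : ℕ}

theorem colorOf_congr (σ : List V → ℕ) {s t : ℕ → V} {i : ℕ} (h : ∀ j ≤ i, s j = t j) :
    colorOf σ s i = colorOf σ t i := by
  unfold colorOf
  congr 2
  funext j
  exact h j (by omega)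

theorem AlgWins.width_le [Nonempty V] {k : ℕ} {σ : List V → ℕ} (h : AlgWins G w k σ) :
    w ≤ k := by
  obtain ⟨v⟩ := ‹Nonempty V›
  obtain ⟨hlt, hne⟩ := h w (fun _ => v) ⟨id, fun i hi => hi, fun i j _ _ hij => hij.1⟩
  have := Finset.card_le_card_of_injOn (s := Finset.range w) (t := Finset.range k)
    (colorOf σ fun _ => v) (fun i hi => by simpa using hlt i (by simpa using hi))
    (fun i hi j hj hij => by
      by_contra hne'
      exact hne i j (by simpa using hi) (by simpa using hj) ⟨hne', Or.inl rfl⟩ hij)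
  simpa using this

theorem gameValue_eq_width_iff [Nonempty V] (hw : 0 < w) :
    gameValue G w = w ↔ ∃ σ, AlgWins G w w σ := by
  unfold gameValue
  constructor
  · intro h
    have hne : {k | ∃ σ : List V → ℕ, AlgWins G w k σ}.Nonempty := by
      by_contra hempty
      rw [Set.not_nonempty_iff_eq_empty] at hempty
      rw [hempty, Nat.sInf_empty] at h
      omega
    have := Nat.sInf_mem hne
    rwa [h] at this
  · intro h
    exact IsLeast.csInf_eq ⟨h, fun k ⟨_, hσ⟩ => hσ.width_le⟩

theorem LegalPlay.card_le {s : ℕ → V} {n : ℕ} (h : LegalPlay G w s n) {T : Finset ℕ}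
    (hT : ∀ i ∈ T, i < n) (hclique : ∀ i ∈ T, ∀ j ∈ T, i ≠ j → TokenAdj G s i j) :
    T.card ≤ w := by
  obtain ⟨φ, hlt, hne⟩ := h
  have := Finset.card_le_card_of_injOn (s := T) (t := Finset.range w) φ
    (fun i hi => by simpa using hlt i (hT i hi))
    (fun i hi j hj hij => by
      by_contra hne'
      exact hne i j (hT i hi) (hT j hj) (hclique i hi j hj hne') hij)
  simpa using this

end Game

section InducedPaths

variable {V : Type*} {G : SimpleGraph V}

/-- `a`, `b`, `c`, `d` induce, in this order, a path on four vertices. -/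
def IsInducedP4 (G : SimpleGraph V) (a b c d : V) : Prop :=
  G.Adj a b ∧ G.Adj b c ∧ G.Adj c d ∧ ¬ G.Adj a c ∧ ¬ G.Adj a d ∧ ¬ G.Adj b d

theorem IsInducedP4.ne {a b c d : V} (h : IsInducedP4 G a b c d) :
    a ≠ b ∧ b ≠ c ∧ c ≠ d ∧ a ≠ c ∧ a ≠ d ∧ b ≠ d := by
  obtain ⟨hab, hbc, hcd, hac, had, hbd⟩ := h
  refine ⟨hab.ne, hbc.ne, hcd.ne, ?_, ?_, ?_⟩
  · rintro rfl; exact had hcd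
  · rintro rfl; exact hac hcd.symm
  · rintro rfl; exact had hab

theorem nonempty_pathGraph_four_embedding_iff :
    Nonempty (pathGraph 4 ↪g G) ↔ ∃ a b c d, IsInducedP4 G a b c d := by
  constructor
  · rintro ⟨f⟩
    refine ⟨f 0, f 1, f 2, f 3, ?_⟩
    simp [IsInducedP4, pathGraph_adj]
  · rintro ⟨a, b, c, d, h⟩
    obtain ⟨nab, nbc, ncd, nac, nad, nbd⟩ := h.ne
    obtain ⟨hab, hbc, hcd, hac, had, hbd⟩ := h
    refine ⟨⟨⟨![a, b, c, d], ?_⟩, ?_⟩⟩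
    · intro i j hij
      fin_cases i <;> fin_cases j <;> simp_all
    · intro i j
      change G.Adj (![a, b, c, d] i) (![a, b, c, d] j) ↔ _
      fin_cases i <;> fin_cases j <;>
        simp_all [pathGraph_adj, G.adj_comm]

/-- `p 0, …, p d` are the consecutive vertices of an induced path. -/
def IsInducedPath (G : SimpleGraph V) (p : ℕ → V) (d : ℕ) : Prop :=
  ∀ i j, i ≤ d → j ≤ d → (p i = p j → i = j) ∧ (G.Adj (p i) (p j) ↔ i + 1 = j ∨ j + 1 = i)

theorem AlgWins.color_parity {σ : List V → ℕ} (hσ : AlgWins G 2 2 σ) {p : ℕ → V} {d : ℕ}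
    (hd : 1 ≤ d) (hp : IsInducedPath G p d) {t : ℕ → V} (h0 : t 0 = p 0) (h1 : t 1 = p d) :
    (colorOf σ t 1 + d) % 2 = colorOf σ t 0 % 2 := by
  obtain ⟨pos, hpos⟩ : ∃ f : ℕ → ℕ, ∀ i, f i = if i = 0 then 0 else if i = 1 then d else i - 1 :=
    ⟨_, fun _ => rfl⟩
  obtain ⟨tok, htok⟩ : ∃ f : ℕ → ℕ, ∀ m, f m = if m = 0 then 0 else if m = d then 1 else m + 1 :=
    ⟨_, fun _ => rfl⟩
  set s : ℕ → V := fun i => p (pos i) with hs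
  have hle : ∀ i < d + 1, pos i ≤ d := by
    intro i hi
    rw [hpos]
    split_ifs <;> omega
  have hinv : ∀ m ≤ d, pos (tok m) = m := by
    grind
  have htok_lt : ∀ m ≤ d, tok m < d + 1 := by
    intro m hm
    rw [htok]
    split_ifs <;> omega
  obtain ⟨hlt, hne⟩ := hσ (d + 1) s ⟨fun i => pos i % 2, fun i _ => Nat.mod_lt _ two_pos, by
    rintro i j hi hj ⟨hij, hadj⟩
    obtain ⟨hinj, hadj'⟩ := hp (pos i) (pos j) (hle i hi) (hle j hj)
    rcases hadj with h | h
    · have := hinj h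
      rw [hpos, hpos] at this
      split_ifs at this <;> omega
    · have := hadj'.1 h
      dsimp only
      omega⟩
  have key : ∀ m ≤ d, (colorOf σ s (tok m) + m) % 2 = colorOf σ s 0 % 2 := by
    intro m
    induction m with
    | zero => simp [htok]
    | succ m ih =>
      intro hm
      have ih := ih (by omega)
      have hpi := hinv m (by omega)
      have hpj := hinv (m + 1) hm
      have hne' := hne (tok m) (tok (m + 1)) (htok_lt m (by omega)) (htok_lt _ hm)
        ⟨fun h => by rw [h] at hpi; omega, Or.inr (by
          simp only [hs, hpi, hpj]
          exact (hp m (m + 1) (by omega) hm).2.2 (Or.inl rfl))⟩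
      have := hlt _ (htok_lt m (by omega))
      have := hlt _ (htok_lt _ hm)
      omega
  have h := key d le_rfl
  have e0 : colorOf σ t 0 = colorOf σ s 0 := colorOf_congr σ (by
    intro j hj
    obtain rfl : j = 0 := by omega
    simpa [hs, hpos] using h0)
  have e1 : colorOf σ t 1 = colorOf σ s 1 := colorOf_congr σ (by
    intro j hj
    obtain rfl | rfl : j = 0 ∨ j = 1 := by omega
    · simpa [hs, hpos] using h0
    · simpa [hs, hpos] using h1)
  rw [e0, e1]
  simpa [htok, show d ≠ 0 by omega] using h

/-- Any two induced paths with common nonadjacent ends have lengths of the same parity. -/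
def ParityConsistent (G : SimpleGraph V) : Prop :=
  ∀ (p q : ℕ → V) (m n : ℕ), 1 ≤ m → 1 ≤ n → IsInducedPath G p m → IsInducedPath G q n →
    p 0 = q 0 → p m = q n → m % 2 = n % 2

theorem AlgWins.parityConsistent {σ : List V → ℕ} (hσ : AlgWins G 2 2 σ) :
    ParityConsistent G := by
  intro p q m n hm hn hp hq h0 h1
  have hp' := hσ.color_parity hm hp (t := fun i => if i = 0 then p 0 else p m) rfl rfl
  have hq' := hσ.color_parity hn hq (t := fun i => if i = 0 then p 0 else p m) h0 h1
  omega

theorem IsInducedP4.isInducedPath {a b c d : V} (h : IsInducedP4 G a b c d) :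
    IsInducedPath G (fun i => if i = 0 then a else if i = 1 then b else if i = 2 then c else d)
      3 := by
  obtain ⟨nab, nbc, ncd, nac, nad, nbd⟩ := h.ne
  obtain ⟨hab, hbc, hcd, hac, had, hbd⟩ := h
  intro i j hi hj
  interval_cases i <;> interval_cases j <;> simp_all [G.adj_comm, eq_comm]

theorem isInducedPath_two {a b c : V} (hab : G.Adj a b) (hbc : G.Adj b c) (hac : ¬ G.Adj a c)
    (hne : a ≠ c) : IsInducedPath G (fun i => if i = 0 then a else if i = 1 then b else c) 2 := by
  have := hab.ne
  have := hbc.ne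
  intro i j hi hj
  interval_cases i <;> interval_cases j <;> simp_all [G.adj_comm, eq_comm]

theorem ParityConsistent.not_adj_ends (hG : ParityConsistent G) {a b c d y : V}
    (h : IsInducedP4 G a b c d) (hya : G.Adj y a) : ¬ G.Adj y d := by
  intro hyd
  have := hG _ _ 3 2 (by omega) (by omega) h.isInducedPath
    (isInducedPath_two hya.symm hyd h.2.2.2.2.1 h.ne.2.2.2.2.1) (by simp) (by simp)
  omega

/-- `G` has no induced bull: a vertex adjacent to both midpoints of an induced `P₄` is
adjacent to one of its ends. -/
def BullFree (G : SimpleGraph V) : Prop :=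
  ∀ a b c d y, IsInducedP4 G a b c d → G.Adj y b → G.Adj y c → G.Adj y a ∨ G.Adj y d

theorem AlgWins.color_eq_of_common_neighbor {σ : List V → ℕ} (hσ : AlgWins G 2 2 σ)
    {x z v u : V} (hxz : ¬ G.Adj x z) (nxz : x ≠ z) (hvx : ¬ G.Adj v x) (nvx : v ≠ x)
    (hvz : ¬ G.Adj v z) (nvz : v ≠ z) {t : ℕ → V} (h0 : t 0 = x) (h1 : t 1 = z) (h2 : t 2 = v)
    {k : ℕ} (hk : k < 2) (hu : G.Adj u (t k)) (huv : G.Adj u v) :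
    colorOf σ t k = colorOf σ t 2 := by
  set s : ℕ → V := fun i => if i < 3 then t i else u with hs
  have s0 : s 0 = x := by simp [hs, h0]
  have s1 : s 1 = z := by simp [hs, h1]
  have s2 : s 2 = v := by simp [hs, h2]
  have s3 : s 3 = u := by simp [hs]
  have hst : ∀ i < 3, colorOf σ t i = colorOf σ s i := fun i hi =>
    colorOf_congr σ fun j hj => by simp [hs, show j < 3 by omega]
  obtain ⟨hlt, hne⟩ := hσ 4 s ⟨fun i => if i = 3 then 1 else 0, by
      intro i _
      dsimp only
      split_ifs <;> omega, by
    rintro i j hi hj ⟨hij, hadj⟩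
    interval_cases i <;> interval_cases j <;>
      simp_all [G.adj_comm, eq_comm]⟩
  have hk' := hne k 3 (by omega) (by omega) ⟨by omega, Or.inr (by
    rw [s3, show s k = t k by simp [hs, show k < 3 by omega]]; exact hu.symm)⟩
  have h2' := hne 2 3 (by omega) (by omega) ⟨by omega, Or.inr (by rw [s2, s3]; exact huv.symm)⟩
  have := hlt k (by omega)
  have := hlt 2 (by omega)
  have := hlt 3 (by omega)
  rw [hst k (by omega), hst 2 (by omega)]
  omega

theorem AlgWins.bullFree {σ : List V → ℕ} (hσ : AlgWins G 2 2 σ) : BullFree G := by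
  intro a b c d y h hyb hyc
  by_contra! hcon
  obtain ⟨hya, hyd⟩ := hcon
  obtain ⟨nab, nbc, ncd, nac, nad, nbd⟩ := h.ne
  have hpar := hσ.color_parity (by omega) h.isInducedPath
    (t := fun i => if i = 0 then a else if i = 1 then d else y) (by simp) (by simp)
  obtain ⟨hab, hbc, hcd, hac, had, hbd⟩ := h
  have nya : y ≠ a := by rintro rfl; exact hac hyc
  have nyd : y ≠ d := by rintro rfl; exact hbd hyb.symm
  have e0 := hσ.color_eq_of_common_neighbor had nad hya nya hyd nyd
    (t := fun i => if i = 0 then a else if i = 1 then d else y) (by simp) (by simp) (by simp)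
    (k := 0) (by omega) (by simpa using hab.symm) hyb.symm
  have e1 := hσ.color_eq_of_common_neighbor had nad hya nya hyd nyd
    (t := fun i => if i = 0 then a else if i = 1 then d else y) (by simp) (by simp) (by simp)
    (k := 1) (by omega) (by simpa using hcd) hyc.symm
  omega

end InducedPaths

section Structure

variable {V : Type*} {G : SimpleGraph V}

/-- The edge `uv` is the base of an induced paw, whose remaining vertices are the top `y` of
the triangle and the pendant vertex `z` attached to it. -/
def PawBase (G : SimpleGraph V) (u v : V) : Prop :=
  G.Adj u v ∧ ∃ y z, G.Adj y u ∧ G.Adj y v ∧ G.Adj y z ∧ ¬ G.Adj z u ∧ ¬ G.Adj z v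

theorem PawBase.symm {u v : V} (h : PawBase G u v) : PawBase G v u := by
  obtain ⟨huv, y, z, hu, hv, hz, hzu, hzv⟩ := h
  exact ⟨huv.symm, y, z, hv, hu, hz, hzv, hzu⟩

theorem adj_top_of_paw (hG : ParityConsistent G) (hB : BullFree G) {u v y z x : V}
    (huv : G.Adj u v) (hyu : G.Adj y u) (hyv : G.Adj y v) (hyz : G.Adj y z) (hzu : ¬ G.Adj z u)
    (hzv : ¬ G.Adj z v) (hxu : G.Adj x u) (hxv : ¬ G.Adj x v) : G.Adj x y ∧ ¬ G.Adj z x := by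
  have hzx : ¬ G.Adj z x := fun hzx =>
    hG.not_adj_ends (a := v) (b := u) (c := x) (d := z)
      ⟨huv.symm, hxu.symm, hzx.symm, fun h => hxv h.symm, fun h => hzv h.symm,
        fun h => hzu h.symm⟩ hyv hyz
  refine ⟨?_, hzx⟩
  by_contra hxy
  rcases hB x u y z v ⟨hxu, hyu.symm, hyz, hxy, fun h => hzx h.symm, fun h => hzu h.symm⟩
    huv.symm hyv.symm with h | h
  · exact hxv h.symm
  · exact hzv h.symm

theorem PawBase.extend (hG : ParityConsistent G) (hB : BullFree G) {u v x : V}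
    (h : PawBase G u v) (hxu : G.Adj x u) (hxv : ¬ G.Adj x v) : PawBase G x u := by
  obtain ⟨huv, y, z, hyu, hyv, hyz, hzu, hzv⟩ := h
  obtain ⟨hxy, hzx⟩ := adj_top_of_paw hG hB huv hyu hyv hyz hzu hzv hxu hxv
  exact ⟨hxu, y, z, hxy.symm, hyu, hyz, hzx, hzu⟩

theorem IsInducedP4.not_pawBase_mid (hG : ParityConsistent G) (hB : BullFree G) {a b c d : V}
    (h : IsInducedP4 G a b c d) : ¬ PawBase G b c := by
  rintro ⟨hbc, y, z, hyb, hyc, hyz, hzb, hzc⟩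
  have hay := (adj_top_of_paw hG hB hbc hyb hyc hyz hzb hzc h.1 h.2.2.2.1).1
  have hdy := (adj_top_of_paw hG hB hbc.symm hyc hyb hyz hzc hzb h.2.2.1.symm
    fun hdb => h.2.2.2.2.2 hdb.symm).1
  exact hG.not_adj_ends h hay.symm hdy.symm

theorem IsInducedP4.not_pawBase_end (hG : ParityConsistent G) (hB : BullFree G) {a b c d : V}
    (h : IsInducedP4 G a b c d) : ¬ PawBase G a b := fun hab =>
  h.not_pawBase_mid hG hB
    (hab.symm.extend hG hB h.2.1.symm fun hca => h.2.2.2.1 hca.symm).symm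

theorem IsInducedP4.replace (hG : ParityConsistent G) (hB : BullFree G) {a b b' c d : V}
    (h : IsInducedP4 G a b c d) (hb : PawBase G b b') : IsInducedP4 G a b' c d := by
  have hab' : G.Adj a b' := by
    by_contra hab'
    exact h.not_pawBase_end hG hB (hb.extend hG hB h.1 hab')
  have hcb' : G.Adj c b' := by
    by_contra hcb'
    exact h.not_pawBase_mid hG hB (hb.extend hG hB h.2.1.symm hcb').symm
  exact ⟨hab', hcb'.symm, h.2.2.1, h.2.2.2.1, h.2.2.2.2.1, hG.not_adj_ends h hab'.symm⟩

theorem not_isInducedP4_of_triangle (hG : ParityConsistent G) {a b c : V} (hab : G.Adj a b)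
    (hbc : G.Adj b c) (hac : G.Adj a c) (nab : ¬ PawBase G a b) (nbc : ¬ PawBase G b c)
    (nac : ¬ PawBase G a c) {p q r s : V} (hp : G.Reachable a p) : ¬ IsInducedP4 G p q r s := by
  have key : ∀ x, G.Reachable a x →
      (G.Adj x a ∧ G.Adj x b) ∨ (G.Adj x b ∧ G.Adj x c) ∨ (G.Adj x a ∧ G.Adj x c) := by
    intro x hx
    rw [reachable_iff_reflTransGen] at hx
    induction hx with
    | refl => exact Or.inr (Or.inl ⟨hab, hac⟩)
    | @tail x y _ hxy ih =>
      by_contra hcon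
      have tab : G.Adj x a → G.Adj x b → G.Adj y a ∨ G.Adj y b := fun h1 h2 => by
        by_contra! h
        exact nab ⟨hab, x, y, h1, h2, hxy, h.1, h.2⟩
      have tbc : G.Adj x b → G.Adj x c → G.Adj y b ∨ G.Adj y c := fun h1 h2 => by
        by_contra! h
        exact nbc ⟨hbc, x, y, h1, h2, hxy, h.1, h.2⟩
      have tac : G.Adj x a → G.Adj x c → G.Adj y a ∨ G.Adj y c := fun h1 h2 => by
        by_contra! h
        exact nac ⟨hac, x, y, h1, h2, hxy, h.1, h.2⟩
      have ta : G.Adj y a → G.Adj y b ∨ G.Adj y c := fun h1 => by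
        by_contra! h
        exact nbc ⟨hbc, a, y, hab, hac, h1.symm, h.1, h.2⟩
      have tb : G.Adj y b → G.Adj y a ∨ G.Adj y c := fun h1 => by
        by_contra! h
        exact nac ⟨hac, b, y, hab.symm, hbc, h1.symm, h.1, h.2⟩
      have tc : G.Adj y c → G.Adj y a ∨ G.Adj y b := fun h1 => by
        by_contra! h
        exact nab ⟨hab, c, y, hac.symm, hbc.symm, h1.symm, h.1, h.2⟩
      grind
  intro h
  have hs : G.Reachable a s :=
    ((hp.trans h.1.reachable).trans h.2.1.reachable).trans h.2.2.1.reachable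
  have ha := fun h' : G.Adj a p => hG.not_adj_ends h h'
  have hb := fun h' : G.Adj b p => hG.not_adj_ends h h'
  have hc := fun h' : G.Adj c p => hG.not_adj_ends h h'
  have h1 := key p hp
  have h2 := key s hs
  simp only [G.adj_comm p, G.adj_comm s] at h1 h2
  grind

theorem exists_isInducedPath_of_reachable {r u : V} (h : G.Reachable r u) :
    ∃ p : ℕ → V, p 0 = r ∧ p (G.dist r u) = u ∧ (∀ i ≤ G.dist r u, G.dist r (p i) = i) ∧
      IsInducedPath G p (G.dist r u) := by
  obtain ⟨q, hq⟩ := h.exists_walk_length_eq_dist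
  set d := G.dist r u with hd
  have hadj : ∀ i < d, G.Adj (q.getVert i) (q.getVert (i + 1)) := fun i hi =>
    q.adj_getVert_succ (by omega)
  have hend : q.getVert d = u := by rw [← hq]; exact q.getVert_length
  have hle : ∀ i ≤ d, G.dist r (q.getVert i) ≤ i := by
    intro i
    induction i with
    | zero => simp
    | succ i ih =>
      intro hi
      have := ih (by omega)
      have := (hadj i (by omega)).diff_dist_adj (u := r)
      omega
  have hge : ∀ k ≤ d, d ≤ G.dist r (q.getVert (d - k)) + k := by
    intro k
    induction k with
    | zero => simp [hend, ← hd]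
    | succ k ih =>
      intro hk
      have := ih (by omega)
      have h2 := (hadj (d - (k + 1)) (by omega)).diff_dist_adj (u := r)
      rw [show d - (k + 1) + 1 = d - k by omega] at h2
      omega
  have hdist : ∀ i ≤ d, G.dist r (q.getVert i) = i := by
    intro i hi
    have h1 := hle i hi
    have h2 := hge (d - i) (by omega)
    rw [show d - (d - i) = i by omega] at h2
    omega
  refine ⟨q.getVert, q.getVert_zero, hend, hdist, fun i j hi hj => ?_⟩
  have h1 := hdist i hi
  have h2 := hdist j hj
  have hinj : q.getVert i = q.getVert j → i = j := fun h => by rw [← h1, ← h2, h]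
  refine ⟨hinj, fun h => ?_, ?_⟩
  · have hij : i ≠ j := by rintro rfl; exact G.irrefl h
    have := h.diff_dist_adj (u := r)
    have := h.symm.diff_dist_adj (u := r)
    omega
  · rintro (rfl | rfl)
    · exact hadj i (by omega)
    · exact (hadj j (by omega)).symm

theorem IsInducedPath.snoc {p : ℕ → V} {d : ℕ} {v : V} (hp : IsInducedPath G p d)
    (hv : ∀ i ≤ d, p i ≠ v ∧ (G.Adj (p i) v ↔ i = d)) :
    IsInducedPath G (fun i => if i ≤ d then p i else v) (d + 1) := by
  intro i j hi hj
  rcases Nat.lt_or_ge d i with hi' | hi' <;> rcases Nat.lt_or_ge d j with hj' | hj'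
  · obtain rfl : i = d + 1 := by omega
    obtain rfl : j = d + 1 := by omega
    simp
  · obtain rfl : i = d + 1 := by omega
    obtain ⟨h1, h2⟩ := hv j hj'
    simp only [Nat.not_succ_le_self, if_false, hj', if_true, G.adj_comm v, h2]
    exact ⟨fun h => absurd h.symm h1, by omega⟩
  · obtain rfl : j = d + 1 := by omega
    obtain ⟨h1, h2⟩ := hv i hi'
    simp only [Nat.not_succ_le_self, if_false, hi', if_true, h2]
    exact ⟨fun h => absurd h h1, by omega⟩
  · simpa only [hi', hj', if_true] using hp i j hi' hj'

theorem ParityConsistent.colorable_two (hG : ParityConsistent G)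
    (htri : ∀ a b c, G.Adj a b → G.Adj b c → ¬ G.Adj a c) : G.Colorable 2 := by
  let root : V → V := fun v => (G.connectedComponentMk v).out
  have hroot : ∀ v, G.Reachable (root v) v := fun v =>
    ConnectedComponent.exact (Quot.out_eq (G.connectedComponentMk v))
  let C : G.Coloring Bool := Coloring.mk (fun v => decide (G.dist (root v) v % 2 = 0)) (by
    intro u v huv heq
    have hrr : root u = root v := by
      simp only [root, ConnectedComponent.connectedComponentMk_eq_of_adj huv]
    have hru := hroot u
    have hrv := hroot v
    rw [hrr] at hru heq
    obtain ⟨r, hr⟩ : ∃ r, r = root v := ⟨_, rfl⟩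
    rw [← hr] at hru hrv heq
    have hd : G.dist r v = G.dist r u := by
      have := huv.diff_dist_adj (u := r)
      have := huv.symm.diff_dist_adj (u := r)
      rw [decide_eq_decide] at heq
      omega
    obtain ⟨p, hp0, hpd, -, hp⟩ := exists_isInducedPath_of_reachable hru
    obtain ⟨q, hq0, hqd, hqdist, hq⟩ := exists_isInducedPath_of_reachable hrv
    rw [hd] at hqd hqdist hq
    obtain ⟨d, hdu⟩ : ∃ d, d = G.dist r u := ⟨_, rfl⟩
    rw [← hdu] at hpd hp hqd hqdist hq hd
    have hd0 : d ≠ 0 := fun h => by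
      rw [h] at hpd hqd
      rw [← hpd, hp0, ← hqd, hq0] at huv
      exact G.irrefl huv
    have hq' : IsInducedPath G _ (d + 1) := hq.snoc (v := u) (fun i hi => by
      have hqi := hqdist i hi
      refine ⟨?_, ?_, ?_⟩
      · rintro rfl
        obtain rfl : i = d := by omega
        exact huv.ne hqd
      · intro h
        by_contra hid
        have := h.diff_dist_adj (u := r)
        have hi1 : i + 1 = d := by omega
        have := (hq i d hi le_rfl).2.2 (Or.inl hi1)
        rw [hqd] at this
        exact htri _ _ _ h huv this
      · rintro rfl
        rw [hqd]
        exact huv.symm)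
    have := hG _ _ d (d + 1) (by omega) (by omega) hp hq' (by simp [hp0, hq0]) (by simp [hpd])
    omega)
  simpa using C.colorable

theorem ParityConsistent.of_embedding {W : Type*} {H : SimpleGraph W} (hG : ParityConsistent G)
    (f : H ↪g G) : ParityConsistent H := by
  have hf : ∀ p d, IsInducedPath H p d → IsInducedPath G (fun i => f (p i)) d := by
    intro p d hp i j hi hj
    simpa [f.injective.eq_iff] using hp i j hi hj
  intro p q m n hm hn hp hq h0 h1
  exact hG _ _ m n hm hn (hf p m hp) (hf q n hq) (congrArg f h0) (congrArg f h1)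

/-- The edges of `G` that must lie inside a fiber: bases of induced paws, and all edges of the
`P₄`-free components. -/
def innerGraph (G : SimpleGraph V) : SimpleGraph V where
  Adj u v := PawBase G u v ∨
    (G.Adj u v ∧ ∀ a b c d, G.Reachable u a → ¬ IsInducedP4 G a b c d)
  symm := ⟨fun _ _ h => h.imp PawBase.symm fun h =>
    ⟨h.1.symm, fun a b c d ha => h.2 a b c d (h.1.reachable.trans ha)⟩⟩
  loopless := ⟨fun _ h => h.elim (fun h => G.irrefl h.1) (fun h => G.irrefl h.1)⟩

theorem adj_of_innerGraph_reachable (hG : ParityConsistent G) (hB : BullFree G) {u v x : V}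
    (huv : (innerGraph G).Reachable u v) (hx : ¬ (innerGraph G).Reachable u x)
    (hxu : G.Adj x u) : G.Adj x v := by
  rw [reachable_iff_reflTransGen] at huv
  induction huv with
  | refl => exact hxu
  | @tail v v' huv hvv' ih =>
    by_contra hxv'
    rw [← reachable_iff_reflTransGen] at huv
    have hvx : (innerGraph G).Adj v x := hvv'.elim
      (fun h => Or.inl (h.extend hG hB ih hxv').symm) fun h => Or.inr ⟨ih.symm, h.2⟩
    exact hx (huv.trans hvx.reachable)

theorem IsInducedP4.not_innerGraph_reachable (hG : ParityConsistent G) (hB : BullFree G)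
    {a b c d : V} (h : IsInducedP4 G a b c d) : ¬ (innerGraph G).Reachable b c := by
  intro hbc
  have key : ∀ x, (innerGraph G).Reachable b x → IsInducedP4 G a x c d := by
    intro x hx
    rw [reachable_iff_reflTransGen] at hx
    induction hx with
    | refl => exact h
    | tail _ hxy ih =>
      exact hxy.elim (fun hp => ih.replace hG hB hp)
        fun hp => absurd ih (hp.2 _ _ _ _ ih.1.symm.reachable)
  exact G.irrefl (key c hbc).2.1

theorem exists_bipartite_substitution (hG : ParityConsistent G) (hB : BullFree G) :
    ∃ (B : SimpleGraph (innerGraph G).ConnectedComponent), B.Colorable 2 ∧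
      (∀ u v : V, (innerGraph G).connectedComponentMk u ≠ (innerGraph G).connectedComponentMk v →
        (G.Adj u v ↔ B.Adj ((innerGraph G).connectedComponentMk u)
          ((innerGraph G).connectedComponentMk v))) ∧
      ∀ b, ¬ Nonempty (pathGraph 4 ↪g G.induce {v | (innerGraph G).connectedComponentMk v = b}) := by
  have hadj : ∀ u u' v v' : V, (innerGraph G).Reachable u u' → (innerGraph G).Reachable v v' →
      ¬ (innerGraph G).Reachable u v → G.Adj u v → G.Adj u' v' := by
    intro u u' v v' hu hv huv h
    have h1 : G.Adj u v' := adj_of_innerGraph_reachable hG hB hv (fun h => huv h.symm) h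
    exact (adj_of_innerGraph_reachable hG hB hu (fun h => huv (h.trans hv.symm)) h1.symm).symm
  have hout : ∀ b : (innerGraph G).ConnectedComponent,
      (innerGraph G).connectedComponentMk b.out = b := fun b => Quot.out_eq b
  let rep : (innerGraph G).ConnectedComponent ↪ V := ⟨fun b => b.out, fun b b' h => by
    rw [← hout b, ← hout b']
    exact congrArg _ h⟩
  let B := G.comap rep
  have hBadj : ∀ b b', B.Adj b b' ↔ G.Adj b.out b'.out := fun b b' => Iff.rfl
  have hinner : ∀ b b', B.Adj b b' → ¬ (innerGraph G).Adj b.out b'.out := by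
    intro b b' h h'
    have := ConnectedComponent.sound h'.reachable
    rw [hout, hout] at this
    exact h.ne this
  refine ⟨B, (hG.of_embedding (Embedding.comap rep G)).colorable_two ?_, ?_, ?_⟩
  · intro a b c hab hbc hac
    have hno : ∀ p q r s, G.Reachable a.out p → ¬ IsInducedP4 G p q r s := fun p q r s hp =>
      not_isInducedP4_of_triangle hG hab hbc hac (fun h => hinner _ _ hab (Or.inl h))
        (fun h => hinner _ _ hbc (Or.inl h)) (fun h => hinner _ _ hac (Or.inl h)) hp
    exact hinner _ _ hab (Or.inr ⟨hab, hno⟩)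
  · intro u v huv
    have hu : (innerGraph G).Reachable ((innerGraph G).connectedComponentMk u).out u :=
      ConnectedComponent.exact (hout _)
    have hv : (innerGraph G).Reachable ((innerGraph G).connectedComponentMk v).out v :=
      ConnectedComponent.exact (hout _)
    have huv' : ¬ (innerGraph G).Reachable u v := fun h => huv (ConnectedComponent.sound h)
    rw [hBadj]
    exact ⟨hadj _ _ _ _ hu.symm hv.symm huv',
      hadj _ _ _ _ hu hv fun h => huv' ((hu.symm.trans h).trans hv)⟩
  · intro b hb
    obtain ⟨p, q, r, s, h⟩ := nonempty_pathGraph_four_embedding_iff.1 hb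
    exact IsInducedP4.not_innerGraph_reachable hG hB
      (a := p.1) (b := q.1) (c := r.1) (d := s.1) h
      (ConnectedComponent.exact (q.2.trans r.2.symm))

end Structure

section FirstFit

variable {V : Type*} {G : SimpleGraph V} {w : ℕ}

/-- In a graph on `ℕ` without induced `P₄`, a greedy coloring certifies its color of `i` by a
clique of earlier vertices. -/
theorem exists_clique_of_greedy {H : SimpleGraph ℕ} (hH : ∀ a b c d, ¬ IsInducedP4 H a b c d)
    {g : ℕ → ℕ} (hne : ∀ i j, H.Adj i j → g i ≠ g j)
    (hlt : ∀ i, ∀ k < g i, ∃ j < i, H.Adj i j ∧ g j = k) (i : ℕ) :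
    ∃ T : Finset ℕ, i ∈ T ∧ (∀ a ∈ T, a ≤ i) ∧ T.card = g i + 1 ∧
      ∀ a ∈ T, ∀ b ∈ T, a ≠ b → H.Adj a b := by
  classical
  suffices h : ∀ n ≤ g i, ∃ T : Finset ℕ, i ∈ T ∧ (∀ a ∈ T, a ≤ i) ∧ T.card = n + 1 ∧
      (∀ a ∈ T, ∀ b ∈ T, a ≠ b → H.Adj a b) ∧ ∀ a ∈ T, g i - n ≤ g a by
    obtain ⟨T, h1, h2, h3, h4, _⟩ := h (g i) le_rfl
    exact ⟨T, h1, h2, h3, h4⟩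
  intro n
  induction n with
  | zero => exact fun _ => ⟨{i}, by simp⟩
  | succ n ih =>
    intro hn
    obtain ⟨T, hiT, hle, hcard, hclique, hg⟩ := ih (by omega)
    have hnbr : ∀ a ∈ T, ∃ j < a, H.Adj a j ∧ g j = g i - (n + 1) := fun a ha =>
      hlt a _ (by have := hg a ha; omega)
    obtain ⟨x₀, hx₀, -, hgx₀⟩ := hnbr i hiT
    obtain ⟨x, hx, hmax⟩ := Finset.exists_max_image
      ((Finset.range (i + 1)).filter fun x => g x = g i - (n + 1))
      (fun x => (T.filter (H.Adj x)).card) ⟨x₀, by simp [hgx₀]; omega⟩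
    simp only [Finset.mem_filter, Finset.mem_range] at hx hmax
    have hall : ∀ y ∈ T, H.Adj x y := by
      intro y hy
      by_contra hxy
      obtain ⟨x', hx'y, hyx', hgx'⟩ := hnbr y hy
      obtain ⟨z, hz, hzx'⟩ : ∃ z ∈ T.filter (H.Adj x), z ∉ T.filter (H.Adj x') := by
        by_contra! hsub
        have hss : T.filter (H.Adj x) ⊂ T.filter (H.Adj x') :=
          Finset.ssubset_iff_subset_ne.2 ⟨hsub, fun h => hxy (Finset.mem_filter.1
            (h ▸ Finset.mem_filter.2 ⟨hy, hyx'.symm⟩ : y ∈ T.filter (H.Adj x))).2⟩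
        have := Finset.card_lt_card hss
        have := hmax x' ⟨by have := hle y hy; omega, hgx'⟩
        omega
      simp only [Finset.mem_filter, not_and] at hz hzx'
      have hzy : z ≠ y := by rintro rfl; exact hxy hz.2
      exact hH x z y x' ⟨hz.2, hclique z hz.1 y hy hzy, hyx', hxy,
        fun h => hne _ _ h (by rw [hx.2, hgx']), fun h => hzx' hz.1 h.symm⟩
    have hxT : x ∉ T := fun h => by have := hg x h; omega
    refine ⟨insert x T, by simp [hiT], ?_, by rw [Finset.card_insert_of_notMem hxT, hcard], ?_, ?_⟩
    · simp only [Finset.mem_insert, forall_eq_or_imp]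
      exact ⟨by omega, hle⟩
    · simp only [Finset.mem_insert, forall_eq_or_imp]
      refine ⟨⟨fun h => absurd rfl h, fun b hb _ => hall b hb⟩, fun a ha => ⟨fun _ =>
        (hall a ha).symm, hclique a ha⟩⟩
    · simp only [Finset.mem_insert, forall_eq_or_imp]
      exact ⟨by omega, fun a ha => by have := hg a ha; omega⟩

/-- The graph on the tokens of the play `s` in which token adjacency is kept only within the
fibers of `c`. -/
def fiberTokenGraph {β : Type*} (G : SimpleGraph V) (c : V → β) (s : ℕ → V) : SimpleGraph ℕ where
  Adj i j := c (s i) = c (s j) ∧ TokenAdj G s i j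
  symm := ⟨fun _ _ h => ⟨h.1.symm, h.2.1.symm, h.2.2.imp Eq.symm (fun h => h.symm)⟩⟩
  loopless := ⟨fun _ h => h.2.1 rfl⟩

/-- The color of the `i`-th token when a play is colored first-fit, considering only tokens in
the same fiber of `c`. -/
noncomputable def firstFit {β : Type*} (G : SimpleGraph V) (c : V → β) (s : ℕ → V) (i : ℕ) : ℕ :=
  sInf {k | ∀ j : Fin i, (fiberTokenGraph G c s).Adj i j → firstFit G c s j ≠ k}
termination_by i

theorem firstFit_mem {β : Type*} (c : V → β) (s : ℕ → V) (i : ℕ) :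
    ∀ j < i, (fiberTokenGraph G c s).Adj i j → firstFit G c s j ≠ firstFit G c s i := by
  have hne : {k | ∀ j : Fin i, (fiberTokenGraph G c s).Adj i j →
      firstFit G c s j ≠ k}.Nonempty := by
    obtain ⟨k, hk⟩ := Infinite.exists_notMem_finset
      (Finset.univ.image fun j : Fin i => firstFit G c s j)
    simp only [Finset.mem_image, Finset.mem_univ, true_and, not_exists] at hk
    exact ⟨k, fun j _ => hk j⟩
  have h := Nat.sInf_mem hne
  intro j hj hadj
  rw [firstFit.eq_1 G c s i]
  exact h ⟨j, hj⟩ hadj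

theorem firstFit_ne {β : Type*} (c : V → β) (s : ℕ → V) (i j : ℕ)
    (h : (fiberTokenGraph G c s).Adj i j) : firstFit G c s i ≠ firstFit G c s j := by
  rcases lt_trichotomy i j with hij | rfl | hij
  · exact firstFit_mem c s j i hij h.symm
  · exact absurd h (fiberTokenGraph G c s).irrefl
  · exact (firstFit_mem c s i j hij h).symm

theorem exists_of_lt_firstFit {β : Type*} (c : V → β) (s : ℕ → V) (i k : ℕ)
    (hk : k < firstFit G c s i) :
    ∃ j < i, (fiberTokenGraph G c s).Adj i j ∧ firstFit G c s j = k := by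
  rw [firstFit] at hk
  have := Nat.notMem_of_lt_sInf hk
  simp only [Set.mem_ofPred_eq, not_forall, not_not] at this
  obtain ⟨j, hadj, hj⟩ := this
  exact ⟨j, j.2, hadj, hj⟩

theorem firstFit_congr {β : Type*} (c : V → β) {s t : ℕ → V} {i : ℕ} (h : ∀ j ≤ i, s j = t j) :
    firstFit G c s i = firstFit G c t i := by
  induction i using Nat.strong_induction_on with
  | _ i ih =>
    rw [firstFit, firstFit]
    congr 1
    ext k
    refine forall_congr' fun j => ?_
    rw [ih j j.2 fun l hl => h l (by omega)]
    simp only [fiberTokenGraph, TokenAdj, h i le_rfl, h j j.2.le]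

theorem fiberTokenGraph_not_isInducedP4 {β : Type*} {c : V → β}
    (hc : ∀ b, ¬ Nonempty (pathGraph 4 ↪g G.induce {v | c v = b})) (s : ℕ → V) (i j k l : ℕ) :
    ¬ IsInducedP4 (fiberTokenGraph G c s) i j k l := by
  intro h
  obtain ⟨nij, njk, nkl, nik, nil, njl⟩ := h.ne
  obtain ⟨⟨cij, _, aij⟩, ⟨cjk, _, ajk⟩, ⟨ckl, _, akl⟩, hik, hil, hjl⟩ := h
  have hik : ¬ (s i = s k ∨ G.Adj (s i) (s k)) := fun h => hik ⟨cij.trans cjk, nik, h⟩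
  have hil : ¬ (s i = s l ∨ G.Adj (s i) (s l)) := fun h =>
    hil ⟨(cij.trans cjk).trans ckl, nil, h⟩
  have hjl : ¬ (s j = s l ∨ G.Adj (s j) (s l)) := fun h => hjl ⟨cjk.trans ckl, njl, h⟩
  refine hc (c (s i)) (nonempty_pathGraph_four_embedding_iff.2
    ⟨⟨s i, rfl⟩, ⟨s j, cij.symm⟩, ⟨s k, (cij.trans cjk).symm⟩,
      ⟨s l, ((cij.trans cjk).trans ckl).symm⟩, ?_⟩)
  simp only [IsInducedP4, comap_adj, Function.Embedding.subtype_apply]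
  push Not at hik hil hjl
  refine ⟨aij.resolve_left ?_, ajk.resolve_left ?_, akl.resolve_left ?_, hik.2, hil.2, hjl.2⟩
  · intro e; rw [e] at hik; exact ajk.elim hik.1 hik.2
  · intro e; rw [e] at aij; exact aij.elim hik.1 hik.2
  · intro e; rw [e] at ajk; exact ajk.elim hjl.1 hjl.2

theorem exists_algWins_of_substitution [Nonempty V] {β : Type*} {B : SimpleGraph β} {c : V → β}
    (hB : B.Colorable 2) (hadj : ∀ u v : V, c u ≠ c v → (G.Adj u v ↔ B.Adj (c u) (c v)))
    (hc : ∀ b, ¬ Nonempty (pathGraph 4 ↪g G.induce {v | c v = b})) :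
    ∃ σ, AlgWins G w w σ := by
  classical
  obtain ⟨C⟩ := hB
  let color : (ℕ → V) → ℕ → ℕ := fun s i =>
    if C (c (s i)) = 0 then firstFit G c s i else w - 1 - firstFit G c s i
  let σ : List V → ℕ := fun l =>
    color (fun j => l.getD j (Classical.arbitrary V)) (l.length - 1)
  have hσ : ∀ s i, colorOf σ s i = color s i := by
    intro s i
    have hs : ∀ j ≤ i, (List.ofFn fun j : Fin (i + 1) => s j).getD j (Classical.arbitrary V)
        = s j := by
      intro j hj
      rw [List.getD_eq_getElem _ _ (by rw [List.length_ofFn]; omega), List.getElem_ofFn]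
    simp only [colorOf, σ, color, List.length_ofFn, Nat.add_sub_cancel]
    rw [firstFit_congr c hs, hs i le_rfl]
  refine ⟨σ, fun n s hlegal => ?_⟩
  have hclique := exists_clique_of_greedy (fiberTokenGraph_not_isInducedP4 hc s)
    (firstFit_ne c s) (exists_of_lt_firstFit c s)
  have hlt : ∀ i < n, firstFit G c s i < w := by
    intro i hi
    obtain ⟨T, -, hTi, hcard, hT⟩ := hclique i
    have := hlegal.card_le (T := T) (fun a ha => (hTi a ha).trans_lt hi)
      fun a ha b hb hab => (hT a ha b hb hab).2
    omega
  have hcross : ∀ i < n, ∀ j < n, B.Adj (c (s i)) (c (s j)) →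
      firstFit G c s i + firstFit G c s j + 2 ≤ w := by
    intro i hi j hj hij
    obtain ⟨T, hiT, hTi, hcard, hT⟩ := hclique i
    obtain ⟨U, hjU, hUj, hcard', hU⟩ := hclique j
    have cT : ∀ a ∈ T, c (s a) = c (s i) := fun a ha => by
      rcases eq_or_ne a i with rfl | h
      · rfl
      · exact (hT a ha i hiT h).1
    have cU : ∀ a ∈ U, c (s a) = c (s j) := fun a ha => by
      rcases eq_or_ne a j with rfl | h
      · rfl
      · exact (hU a ha j hjU h).1
    have hTU : ∀ a ∈ T, ∀ b ∈ U, G.Adj (s a) (s b) := fun a ha b hb => by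
      rw [hadj _ _ (by rw [cT a ha, cU b hb]; exact hij.ne), cT a ha, cU b hb]
      exact hij
    have hdisj : Disjoint T U := Finset.disjoint_left.2 fun a ha hb => G.irrefl (hTU a ha a hb)
    have := hlegal.card_le (T := T ∪ U)
      (fun a ha => (Finset.mem_union.1 ha).elim (fun h => (hTi a h).trans_lt hi)
        fun h => (hUj a h).trans_lt hj)
      (fun a ha b hb hab => by
        rcases Finset.mem_union.1 ha with ha | ha <;> rcases Finset.mem_union.1 hb with hb | hb
        · exact (hT a ha b hb hab).2
        · exact ⟨hab, Or.inr (hTU a ha b hb)⟩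
        · exact ⟨hab, Or.inr (hTU b hb a ha).symm⟩
        · exact (hU a ha b hb hab).2)
    rw [Finset.card_union_of_disjoint hdisj] at this
    omega
  simp only [hσ, color]
  refine ⟨fun i hi => ?_, fun i j hi hj hij => ?_⟩
  · have := hlt i hi
    split_ifs <;> omega
  · have hi' := hlt i hi
    have hj' := hlt j hj
    by_cases hcij : c (s i) = c (s j)
    · have := firstFit_ne (G := G) c s i j ⟨hcij, hij⟩
      rw [hcij]
      split_ifs <;> omega
    · have hBadj := (hadj _ _ hcij).1 (hij.2.resolve_left fun h => hcij (by rw [h]))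
      have := hcross i hi j hj hBadj
      have := C.valid hBadj
      split_ifs with h1 h2 h2
      · exact absurd (h1.trans h2.symm) this
      · omega
      · omega
      · exact absurd (show C (c (s i)) = C (c (s j)) by omega) this

end FirstFit

/-- A finite (nonempty) graph `G` is online-perfect (`f(w, G) = w` for every positive
integer `w`) if and only if `G` is obtainable from a bipartite graph by replacing each
vertex with a copy of a `P₄`-free graph: there is a bipartite graph `B` and a surjection
`c : V → β` onto the vertices of `B` such that vertices in different fibers are adjacent
exactly when their images are adjacent in `B`, and each fiber induces a `P₄`-free
subgraph of `G`. -/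
theorem online_perfect_iff_substitution {V : Type} [Fintype V] [Nonempty V]
    (G : SimpleGraph V) :
    (∀ w : ℕ, 0 < w → gameValue G w = w) ↔
      ∃ (β : Type) (B : SimpleGraph β) (c : V → β),
        Function.Surjective c ∧ B.Colorable 2 ∧
        (∀ u v : V, c u ≠ c v → (G.Adj u v ↔ B.Adj (c u) (c v))) ∧
        (∀ b : β, ¬ Nonempty (SimpleGraph.pathGraph 4 ↪g G.induce {v | c v = b})) := by
  constructor
  · intro h
    obtain ⟨σ, hσ⟩ := (gameValue_eq_width_iff two_pos).1 (h 2 two_pos)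
    obtain ⟨B, hB, hadj, hfree⟩ := exists_bipartite_substitution hσ.parityConsistent hσ.bullFree
    exact ⟨_, B, (innerGraph G).connectedComponentMk, Quot.mk_surjective, hB, hadj, hfree⟩
  · rintro ⟨β, B, c, -, hB, hadj, hfree⟩ w hw
    exact (gameValue_eq_width_iff hw).2 (exists_algWins_of_substitution hB hadj hfree)
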